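/- arXiv:2602.14142 — 2 statements merged into one kernel-verified Lean document; each statement's English description precedes it below -/
import Mathlib

section
/- There exists n ∈ ℕ with n ≥ 1 such that ∫_{Δ̄} log‖D^{(n)}(x)‖ dμ(x) < 0, where ‖·‖ denotes the operator norm on 2×2 real matrices induced by the ℓ¹ norm on ℝ² (the maximum absolute column sum). -/
open MeasureTheory Matrix

noncomputable section

/-- The four matrices of the Reverse algorithm. -/
def M1 : Matrix (Fin 3) (Fin 3) ℝ := !![1,1,1; 0,1,0; 0,0,1]
def M2 : Matrix (Fin 3) (Fin 3) ℝ := !![1,0,0; 1,1,1; 0,0,1]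
def M3 : Matrix (Fin 3) (Fin 3) ℝ := !![1,0,0; 0,1,0; 1,1,1]
def M4 : Matrix (Fin 3) (Fin 3) ℝ := !![0,1,1; 1,0,1; 1,1,0]

def Mat : Fin 4 → Matrix (Fin 3) (Fin 3) ℝ := ![M1, M2, M3, M4]

/-- The closed standard 2-simplex in ℝ³. -/
def simplexBar : Set (Fin 3 → ℝ) := {x | (∀ i, 0 ≤ x i) ∧ x 0 + x 1 + x 2 = 1}

/-- The open standard 2-simplex in ℝ³. -/
def simplexOpen : Set (Fin 3 → ℝ) := {x | (∀ i, 0 < x i) ∧ x 0 + x 1 + x 2 = 1}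

/-- The projectivized Reverse algorithm map. -/
def fR (x : Fin 3 → ℝ) : Fin 3 → ℝ :=
  if 1 < 2 * x 0 then ![(x 0 - x 1 - x 2) / x 0, x 1 / x 0, x 2 / x 0]
  else if 1 < 2 * x 1 then ![x 0 / x 1, (-x 0 + x 1 - x 2) / x 1, x 2 / x 1]
  else if 1 < 2 * x 2 then ![x 0 / x 2, x 1 / x 2, (-x 0 - x 1 + x 2) / x 2]
  else ![-x 0 + x 1 + x 2, x 0 - x 1 + x 2, x 0 + x 1 - x 2]

/-- The digit `a(x)` of a point: the index of the cell `Δ(a(x))` containing `x`. -/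
def digit (x : Fin 3 → ℝ) : Fin 4 :=
  if 1 < 2 * x 0 then 0 else if 1 < 2 * x 1 then 1 else if 1 < 2 * x 2 then 2 else 3

/-- The cocycle `A^{(n)}(x) = ᵗM_{a(f^{n-1}x)} ⋯ ᵗM_{a(fx)} ᵗM_{a(x)}`. -/
def Acoc : ℕ → (Fin 3 → ℝ) → Matrix (Fin 3) (Fin 3) ℝ
  | 0, _ => 1
  | n+1, x => Acoc n (fR x) * (Mat (digit x))ᵀ

/-- The invariant measure μ of the Reverse algorithm: in coordinates (x₁,x₂) it has
density 4/(π²(x₁+x₂)(1-x₁)(1-x₂)) on the open triangle. -/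
def muR : Measure (Fin 3 → ℝ) :=
  Measure.map (fun p : ℝ × ℝ => ![1 - p.1 - p.2, p.1, p.2])
    (((volume : Measure (ℝ × ℝ)).restrict
        {p : ℝ × ℝ | 0 < p.1 ∧ 0 < p.2 ∧ p.1 + p.2 < 1}).withDensity
      (fun p => ENNReal.ofReal (4 / (Real.pi ^ 2 * (p.1 + p.2) * (1 - p.1) * (1 - p.2)))))


/-- The 2×3 projection matrix Π. -/
def Pi23 : Matrix (Fin 2) (Fin 3) ℝ := !![-1,1,0; -1,0,1]

/-- The 3×2 matrix H(x). -/
def Hmat (x : Fin 3 → ℝ) : Matrix (Fin 3) (Fin 2) ℝ :=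
  !![-x 1, -x 2; 1 - x 1, -x 2; -x 1, 1 - x 2]

/-- The 2×2 matrices `D^{(n)}(x) = Π · A^{(n)}(x) · H(x)`. -/
def Dcoc (n : ℕ) (x : Fin 3 → ℝ) : Matrix (Fin 2) (Fin 2) ℝ :=
  Pi23 * Acoc n x * Hmat x

/-- The operator norm on 2×2 real matrices induced by the ℓ¹ norm on ℝ²:
the maximum absolute column sum. -/
def colSumNorm (B : Matrix (Fin 2) (Fin 2) ℝ) : ℝ :=
  max (|B 0 0| + |B 1 0|) (|B 0 1| + |B 1 1|)

/-! ### The oscillation seminorm -/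

/-- The oscillation `max v - min v` of a vector of `ℝ³`. -/
def osc (v : Fin 3 → ℝ) : ℝ := max |v 1 - v 0| (max |v 2 - v 0| |v 2 - v 1|)

lemma osc_le_iff {v : Fin 3 → ℝ} {c : ℝ} :
    osc v ≤ c ↔ |v 1 - v 0| ≤ c ∧ |v 2 - v 0| ≤ c ∧ |v 2 - v 1| ≤ c := by
  simp [osc]

/-- A vector orthogonal to a point of the simplex has both a nonnegative and a nonpositive entry. -/
lemma exists_nonneg_nonpos {x v : Fin 3 → ℝ} (hx : x ∈ simplexBar) (h : v ⬝ᵥ x = 0) :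
    (∃ p, 0 ≤ v p) ∧ ∃ q, v q ≤ 0 := by
  obtain ⟨hx0, hx1⟩ := hx
  have h0 := hx0 0
  have h1 := hx0 1
  have h2 := hx0 2
  simp only [dotProduct, Fin.sum_univ_three] at h
  constructor
  · by_contra! hc
    have a := hc 0
    have b := hc 1
    have c := hc 2
    rcases (by by_contra! hh; linarith : 0 < x 0 ∨ 0 < x 1 ∨ 0 < x 2) with h' | h' | h' <;>
      nlinarith [mul_nonneg h0 (neg_nonneg.2 a.le), mul_nonneg h1 (neg_nonneg.2 b.le),
        mul_nonneg h2 (neg_nonneg.2 c.le), mul_pos h' (neg_pos.2 a), mul_pos h' (neg_pos.2 b),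
        mul_pos h' (neg_pos.2 c)]
  · by_contra! hc
    have a := hc 0
    have b := hc 1
    have c := hc 2
    rcases (by by_contra! hh; linarith : 0 < x 0 ∨ 0 < x 1 ∨ 0 < x 2) with h' | h' | h' <;>
      nlinarith [mul_nonneg h0 a.le, mul_nonneg h1 b.le, mul_nonneg h2 c.le, mul_pos h' a,
        mul_pos h' b, mul_pos h' c]

lemma transpose_M1_mulVec (v : Fin 3 → ℝ) : M1ᵀ *ᵥ v = ![v 0, v 0 + v 1, v 0 + v 2] := by
  ext i; fin_cases i <;> simp [M1, mulVec, dotProduct, Fin.sum_univ_three]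

lemma transpose_M2_mulVec (v : Fin 3 → ℝ) : M2ᵀ *ᵥ v = ![v 0 + v 1, v 1, v 1 + v 2] := by
  ext i; fin_cases i <;> simp [M2, mulVec, dotProduct, Fin.sum_univ_three]

lemma transpose_M3_mulVec (v : Fin 3 → ℝ) : M3ᵀ *ᵥ v = ![v 0 + v 2, v 1 + v 2, v 2] := by
  ext i; fin_cases i <;> simp [M3, mulVec, dotProduct, Fin.sum_univ_three]

lemma transpose_M4_mulVec (v : Fin 3 → ℝ) :
    M4ᵀ *ᵥ v = ![v 1 + v 2, v 0 + v 2, v 0 + v 1] := by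
  ext i; fin_cases i <;> simp [M4, mulVec, dotProduct, Fin.sum_univ_three]

lemma abs_le_osc (v : Fin 3 → ℝ) :
    |v 1 - v 0| ≤ osc v ∧ |v 2 - v 0| ≤ osc v ∧ |v 2 - v 1| ≤ osc v :=
  osc_le_iff.1 le_rfl

/-- If `v` takes both signs, none of the four matrices increases its oscillation. -/
lemma osc_transpose_Mat_mulVec_le (a : Fin 4) {v : Fin 3 → ℝ}
    (hp : ∃ p, 0 ≤ v p) (hq : ∃ q, v q ≤ 0) : osc ((Mat a)ᵀ *ᵥ v) ≤ osc v := by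
  obtain ⟨p, hp⟩ := hp
  obtain ⟨q, hq⟩ := hq
  have hv := abs_le_osc v
  generalize osc v = c at *
  simp only [abs_le] at hv
  obtain ⟨⟨_, _⟩, ⟨_, _⟩, ⟨_, _⟩⟩ := hv
  fin_cases a <;>
    simp [Mat, transpose_M1_mulVec, transpose_M2_mulVec, transpose_M3_mulVec,
      transpose_M4_mulVec, osc_le_iff, abs_le] <;>
    fin_cases p <;> fin_cases q <;> simp at hp hq <;> refine ⟨⟨?_, ?_⟩, ⟨?_, ?_⟩, ⟨?_, ?_⟩⟩ <;>
    linarith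

/-- If the image of `v` takes both signs, each of the four matrices decreases the oscillation of
`v` at most by the factor `4`. -/
lemma osc_le_transpose_Mat_mulVec (a : Fin 4) {v : Fin 3 → ℝ}
    (hp : ∃ p, 0 ≤ ((Mat a)ᵀ *ᵥ v) p) (hq : ∃ q, ((Mat a)ᵀ *ᵥ v) q ≤ 0) :
    osc v ≤ 4 * osc ((Mat a)ᵀ *ᵥ v) := by
  obtain ⟨p, hp⟩ := hp
  obtain ⟨q, hq⟩ := hq
  have hv := abs_le_osc ((Mat a)ᵀ *ᵥ v)
  generalize osc ((Mat a)ᵀ *ᵥ v) = c at *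
  fin_cases a <;>
    simp [Mat, transpose_M1_mulVec, transpose_M2_mulVec, transpose_M3_mulVec,
      transpose_M4_mulVec, osc_le_iff, abs_le] at hp hq hv ⊢ <;>
    obtain ⟨⟨_, _⟩, ⟨_, _⟩, ⟨_, _⟩⟩ := hv <;>
    fin_cases p <;> fin_cases q <;> simp at hp hq <;> refine ⟨⟨?_, ?_⟩, ⟨?_, ?_⟩, ⟨?_, ?_⟩⟩ <;>
    linarith

/-- The word `M₁M₂M₃` contracts the oscillation by the factor `3/4`. -/
lemma osc_word_le {v : Fin 3 → ℝ} (hp : ∃ p, 0 ≤ (M3ᵀ *ᵥ (M2ᵀ *ᵥ (M1ᵀ *ᵥ v))) p)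
    (hq : ∃ q, (M3ᵀ *ᵥ (M2ᵀ *ᵥ (M1ᵀ *ᵥ v))) q ≤ 0) :
    osc (M3ᵀ *ᵥ (M2ᵀ *ᵥ (M1ᵀ *ᵥ v))) ≤ 3 / 4 * osc v := by
  obtain ⟨p, hp⟩ := hp
  obtain ⟨q, hq⟩ := hq
  have hv := abs_le_osc v
  generalize osc v = c at *
  simp only [abs_le] at hv
  obtain ⟨⟨_, _⟩, ⟨_, _⟩, ⟨_, _⟩⟩ := hv
  simp [transpose_M1_mulVec, transpose_M2_mulVec, transpose_M3_mulVec, osc_le_iff, abs_le]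
    at hp hq ⊢
  fin_cases p <;> fin_cases q <;> simp at hp hq <;> refine ⟨⟨?_, ?_⟩, ⟨?_, ?_⟩, ⟨?_, ?_⟩⟩ <;>
    linarith

/-! ### The map and the cocycle on the closed simplex -/

lemma fR_mem_simplexBar {x : Fin 3 → ℝ} (hx : x ∈ simplexBar) : fR x ∈ simplexBar := by
  obtain ⟨hx0, hx1⟩ := hx
  have h0 := hx0 0
  have h1 := hx0 1
  have h2 := hx0 2
  unfold fR
  split_ifs with a b c
  · refine ⟨fun i => ?_, ?_⟩
    · fin_cases i <;> simp <;> apply div_nonneg <;> linarith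
    · simp; field_simp [(by linarith : x 0 ≠ 0)]; ring
  · refine ⟨fun i => ?_, ?_⟩
    · fin_cases i <;> simp <;> apply div_nonneg <;> linarith
    · simp; field_simp [(by linarith : x 1 ≠ 0)]; ring
  · refine ⟨fun i => ?_, ?_⟩
    · fin_cases i <;> simp <;> apply div_nonneg <;> linarith
    · simp; field_simp [(by linarith : x 2 ≠ 0)]; ring
  · refine ⟨fun i => ?_, ?_⟩
    · fin_cases i <;> simp <;> linarith
    · simp; linarith

/-- The matrix `ᵗM_{a(x)}` maps the orthogonal of `x` to the orthogonal of `f_R x`. -/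
lemma transpose_Mat_digit_mulVec_dotProduct {x v : Fin 3 → ℝ} (h : v ⬝ᵥ x = 0) :
    ((Mat (digit x))ᵀ *ᵥ v) ⬝ᵥ fR x = 0 := by
  simp only [dotProduct, Fin.sum_univ_three] at h
  unfold fR digit
  split_ifs with a b c
  · have : x 0 ≠ 0 := by rintro h; norm_num [h] at a
    simp [Mat, transpose_M1_mulVec, dotProduct, Fin.sum_univ_three]
    field_simp; linarith
  · have : x 1 ≠ 0 := by rintro h; norm_num [h] at b
    simp [Mat, transpose_M2_mulVec, dotProduct, Fin.sum_univ_three]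
    field_simp; linarith
  · have : x 2 ≠ 0 := by rintro h; norm_num [h] at c
    simp [Mat, transpose_M3_mulVec, dotProduct, Fin.sum_univ_three]
    field_simp; linarith
  · simp [Mat, transpose_M4_mulVec, dotProduct, Fin.sum_univ_three]
    linarith

lemma iterate_fR_mem_simplexBar {x : Fin 3 → ℝ} (hx : x ∈ simplexBar) (n : ℕ) :
    fR^[n] x ∈ simplexBar := by
  induction n with
  | zero => exact hx
  | succ n ih => rw [Function.iterate_succ_apply']; exact fR_mem_simplexBar ih

lemma Acoc_add (m k : ℕ) (x : Fin 3 → ℝ) : Acoc (m + k) x = Acoc k (fR^[m] x) * Acoc m x := by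
  induction m generalizing x with
  | zero => simp [Acoc]
  | succ m ih => rw [Nat.succ_add, Acoc, ih, Acoc, Function.iterate_succ_apply, Matrix.mul_assoc]

lemma Acoc_succ' (n : ℕ) (x : Fin 3 → ℝ) :
    Acoc (n + 1) x = (Mat (digit (fR^[n] x)))ᵀ * Acoc n x := by
  rw [Acoc_add]; simp [Acoc]

lemma Acoc_mulVec_dotProduct (n : ℕ) {x v : Fin 3 → ℝ} (h : v ⬝ᵥ x = 0) :
    (Acoc n x *ᵥ v) ⬝ᵥ fR^[n] x = 0 := by
  induction n with
  | zero => simpa [Acoc] using h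
  | succ n ih =>
    rw [Acoc_succ', ← mulVec_mulVec, Function.iterate_succ_apply']
    exact transpose_Mat_digit_mulVec_dotProduct ih

lemma osc_Acoc_mulVec_antitone {x v : Fin 3 → ℝ} (hx : x ∈ simplexBar) (h : v ⬝ᵥ x = 0) :
    Antitone fun n => osc (Acoc n x *ᵥ v) := by
  refine antitone_nat_of_succ_le fun n => ?_
  obtain ⟨hp, hq⟩ := exists_nonneg_nonpos (iterate_fR_mem_simplexBar hx n)
    (Acoc_mulVec_dotProduct n h)
  rw [Acoc_succ', ← mulVec_mulVec]
  exact osc_transpose_Mat_mulVec_le _ hp hq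

lemma osc_Acoc_mulVec_le {x v : Fin 3 → ℝ} (hx : x ∈ simplexBar) (h : v ⬝ᵥ x = 0) (n : ℕ) :
    osc (Acoc n x *ᵥ v) ≤ osc v := by
  simpa [Acoc] using osc_Acoc_mulVec_antitone hx h (Nat.zero_le n)

lemma osc_le_osc_Acoc_mulVec {x v : Fin 3 → ℝ} (hx : x ∈ simplexBar) (h : v ⬝ᵥ x = 0) (n : ℕ) :
    osc v ≤ 4 ^ n * osc (Acoc n x *ᵥ v) := by
  induction n with
  | zero => simp [Acoc]
  | succ n ih =>
    obtain ⟨hp, hq⟩ := exists_nonneg_nonpos (iterate_fR_mem_simplexBar hx (n + 1))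
      (Acoc_mulVec_dotProduct (n + 1) h)
    rw [Acoc_succ', ← mulVec_mulVec] at hp hq ⊢
    have := osc_le_transpose_Mat_mulVec _ hp hq
    calc _ ≤ _ := ih
      _ ≤ 4 ^ n * (4 * _) := by gcongr
      _ = _ := by ring

/-- The cylinder of the word `M₁M₂M₃`. -/
def wordCylinder : Set (Fin 3 → ℝ) :=
  simplexBar ∩ {x | x 1 + x 2 < x 0 ∧ x 0 < 2 * x 1 ∧ x 1 < 2 * x 2}

lemma Acoc_three_of_mem_wordCylinder {x : Fin 3 → ℝ} (hx : x ∈ wordCylinder) :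
    Acoc 3 x = M3ᵀ * M2ᵀ * M1ᵀ := by
  obtain ⟨⟨hx0, hx1⟩, h1, h2, h3⟩ := hx
  have p0 : 0 < x 0 := by linarith [hx0 1, hx0 2]
  have p1 : 0 < x 1 := by linarith
  have e1 : fR x = ![(x 0 - x 1 - x 2) / x 0, x 1 / x 0, x 2 / x 0] := by
    rw [fR, if_pos (by linarith)]
  have d1 : digit x = 0 := by rw [digit, if_pos (by linarith)]
  have n1 : ¬ 1 < 2 * (fR x) 0 := by
    rw [e1]; simp; rw [← mul_div_assoc, div_le_one p0]; linarith
  have m1 : 1 < 2 * (fR x) 1 := by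
    rw [e1]; simp; rw [← mul_div_assoc, one_lt_div p0]; linarith
  have e2 : fR (fR x) = ![(x 0 - x 1 - x 2) / x 1, (2 * x 1 - x 0) / x 1, x 2 / x 1] := by
    rw [fR, if_neg n1, if_pos m1, e1]
    simp
    field_simp
    ring_nf
    simp
  have d2 : digit (fR x) = 1 := by rw [digit, if_neg n1, if_pos m1]
  have d3 : digit (fR (fR x)) = 2 := by
    rw [digit, if_neg, if_neg, if_pos]
    · rw [e2]; simp; rw [← mul_div_assoc, one_lt_div p1]; linarith
    · rw [e2]; simp; rw [← mul_div_assoc, div_le_one p1]; linarith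
    · rw [e2]; simp; rw [← mul_div_assoc, div_le_one p1]; linarith
  simp [Acoc, d1, d2, d3, Mat, Matrix.mul_assoc]

lemma osc_Acoc_three_le {x v : Fin 3 → ℝ} (hx : x ∈ wordCylinder) (h : v ⬝ᵥ x = 0) :
    osc (Acoc 3 x *ᵥ v) ≤ 3 / 4 * osc v := by
  obtain ⟨hp, hq⟩ := exists_nonneg_nonpos (iterate_fR_mem_simplexBar hx.1 3)
    (Acoc_mulVec_dotProduct 3 h)
  rw [Acoc_three_of_mem_wordCylinder hx, ← mulVec_mulVec, ← mulVec_mulVec] at hp hq ⊢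
  exact osc_word_le hp hq

/-- The cocycle contracts along every orbit that returns infinitely often to the cylinder. -/
lemma exists_forall_osc_Acoc_le_pow {x : Fin 3 → ℝ} (hx : x ∈ simplexBar)
    (hf : ∃ᶠ n in Filter.atTop, fR^[n] x ∈ wordCylinder) (K : ℕ) :
    ∃ n, ∀ v : Fin 3 → ℝ, v ⬝ᵥ x = 0 → osc (Acoc n x *ᵥ v) ≤ (3 / 4) ^ K * osc v := by
  induction K with
  | zero => exact ⟨0, fun v _ => by simp [Acoc]⟩
  | succ K ih =>
    obtain ⟨n, hn⟩ := ih
    obtain ⟨m, hnm, hm⟩ := Filter.frequently_atTop.1 hf n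
    refine ⟨m + 3, fun v hv => ?_⟩
    rw [Acoc_add, ← mulVec_mulVec]
    calc _ ≤ 3 / 4 * osc (Acoc m x *ᵥ v) := osc_Acoc_three_le hm (Acoc_mulVec_dotProduct m hv)
      _ ≤ 3 / 4 * ((3 / 4) ^ K * osc v) := by
        gcongr
        exact (osc_Acoc_mulVec_antitone hx hv hnm).trans (hn v hv)
      _ = _ := by ring

/-! ### The norm of `D` -/

lemma Dcoc_apply (n : ℕ) (x : Fin 3 → ℝ) (i j : Fin 2) :
    Dcoc n x i j =
      (Acoc n x *ᵥ fun k => Hmat x k j) i.succ - (Acoc n x *ᵥ fun k => Hmat x k j) 0 := by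
  rw [Dcoc, Matrix.mul_assoc]
  have : ∀ k, (Acoc n x * Hmat x) k j = (Acoc n x *ᵥ fun k => Hmat x k j) k := fun k => rfl
  rw [Matrix.mul_apply, Fin.sum_univ_three, this, this, this]
  fin_cases i <;> simp [Pi23] <;> ring

lemma Hmat_col_dotProduct {x : Fin 3 → ℝ} (hx : x ∈ simplexBar) (j : Fin 2) :
    (fun k => Hmat x k j) ⬝ᵥ x = 0 := by
  have := hx.2
  fin_cases j <;> simp [Hmat, dotProduct, Fin.sum_univ_three]
  · linear_combination -x 1 * this
  · linear_combination -x 2 * this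

lemma osc_Hmat_col (x : Fin 3 → ℝ) (j : Fin 2) : osc (fun k => Hmat x k j) = 1 := by
  fin_cases j <;> simp [Hmat, osc]
  rw [show -x 1 - (1 - x 1) = -1 by ring]
  simp

lemma colSumNorm_Dcoc_le {n : ℕ} {x : Fin 3 → ℝ} {c : ℝ}
    (h : ∀ j, osc (Acoc n x *ᵥ fun k => Hmat x k j) ≤ c) : colSumNorm (Dcoc n x) ≤ 2 * c := by
  have h0 := osc_le_iff.1 (h 0)
  have h1 := osc_le_iff.1 (h 1)
  simp only [colSumNorm, Dcoc_apply]
  apply max_le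
  · simpa [two_mul] using add_le_add h0.1 h0.2.1
  · simpa [two_mul] using add_le_add h1.1 h1.2.1

lemma le_colSumNorm_Dcoc (n : ℕ) (x : Fin 3 → ℝ) :
    osc (Acoc n x *ᵥ fun k => Hmat x k 0) ≤ colSumNorm (Dcoc n x) := by
  refine le_trans ?_ (le_max_left _ _)
  simp only [Dcoc_apply]
  generalize (Acoc n x *ᵥ fun k => Hmat x k 0) = u
  change _ ≤ |u 1 - u 0| + |u 2 - u 0|
  refine osc_le_iff.2 ⟨by linarith [abs_nonneg (u 2 - u 0)], by linarith [abs_nonneg (u 1 - u 0)],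
    ?_⟩
  have := abs_sub_le (u 2) (u 0) (u 1)
  rw [abs_sub_comm (u 0)] at this
  linarith

lemma colSumNorm_Dcoc_le_two {x : Fin 3 → ℝ} (hx : x ∈ simplexBar) (n : ℕ) :
    colSumNorm (Dcoc n x) ≤ 2 := by
  simpa using colSumNorm_Dcoc_le (c := 1) fun j =>
    (osc_Acoc_mulVec_le hx (Hmat_col_dotProduct hx j) n).trans_eq (osc_Hmat_col x j)

lemma inv_four_pow_le_colSumNorm_Dcoc {x : Fin 3 → ℝ} (hx : x ∈ simplexBar) (n : ℕ) :
    ((4 : ℝ) ^ n)⁻¹ ≤ colSumNorm (Dcoc n x) := by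
  have h := osc_le_osc_Acoc_mulVec hx (Hmat_col_dotProduct hx 0) n
  rw [osc_Hmat_col] at h
  refine le_trans ?_ (le_colSumNorm_Dcoc n x)
  rwa [inv_le_iff_one_le_mul₀' (by positivity)]

lemma eventually_colSumNorm_Dcoc_le {x : Fin 3 → ℝ} (hx : x ∈ simplexBar)
    (hf : ∃ᶠ n in Filter.atTop, fR^[n] x ∈ wordCylinder) {ε : ℝ} (hε : 0 < ε) :
    ∀ᶠ n in Filter.atTop, colSumNorm (Dcoc n x) ≤ ε := by
  obtain ⟨K, hK⟩ := exists_pow_lt_of_lt_one (half_pos hε) (by norm_num : (3 / 4 : ℝ) < 1)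
  obtain ⟨n, hn⟩ := exists_forall_osc_Acoc_le_pow hx hf K
  filter_upwards [Filter.eventually_ge_atTop n] with m hm
  have := colSumNorm_Dcoc_le (n := m) (x := x) (c := ε / 2) fun j => by
    have hj := Hmat_col_dotProduct hx j
    refine (osc_Acoc_mulVec_antitone hx hj hm).trans ((hn _ hj).trans ?_)
    rw [osc_Hmat_col, mul_one]
    exact hK.le
  linarith

/-! ### The invariant measure in the planar chart -/

/-- The open triangle. -/
def triangle : Set (ℝ × ℝ) := {p | 0 < p.1 ∧ 0 < p.2 ∧ p.1 + p.2 < 1}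

/-- The density of the invariant measure in the planar chart. -/
def dens (p : ℝ × ℝ) : ℝ := 4 / (Real.pi ^ 2 * (p.1 + p.2) * (1 - p.1) * (1 - p.2))

/-- The chart of the simplex. -/
def chart (p : ℝ × ℝ) : Fin 3 → ℝ := ![1 - p.1 - p.2, p.1, p.2]

/-- The invariant measure in the planar chart. -/
def nuR : Measure (ℝ × ℝ) :=
  ((volume : Measure (ℝ × ℝ)).restrict triangle).withDensity fun p => ENNReal.ofReal (dens p)

/-- The map `f_R` in the planar chart. -/
def planarMap (p : ℝ × ℝ) : ℝ × ℝ := (fR (chart p) 1, fR (chart p) 2)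

lemma muR_eq : muR = nuR.map chart := rfl

lemma measurable_chart : Measurable chart := by
  refine measurable_pi_lambda _ fun i => ?_
  fin_cases i <;> simp [chart] <;> fun_prop

lemma measurable_dens : Measurable dens := by
  unfold dens; fun_prop

lemma measurableSet_triangle : MeasurableSet triangle := by
  unfold triangle; measurability

lemma measurable_fR : Measurable fR := by
  unfold fR
  refine Measurable.ite (measurableSet_lt (by fun_prop) (by fun_prop)) ?_ <|
    Measurable.ite (measurableSet_lt (by fun_prop) (by fun_prop)) ?_ <|
    Measurable.ite (measurableSet_lt (by fun_prop) (by fun_prop)) ?_ ?_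
  all_goals
    refine measurable_pi_lambda _ fun i => ?_
    fin_cases i <;> simp <;> fun_prop

lemma measurable_digit : Measurable digit := by
  unfold digit
  exact Measurable.ite (measurableSet_lt (by fun_prop) (by fun_prop)) measurable_const <|
    Measurable.ite (measurableSet_lt (by fun_prop) (by fun_prop)) measurable_const <|
    Measurable.ite (measurableSet_lt (by fun_prop) (by fun_prop)) measurable_const measurable_const

lemma measurable_planarMap : Measurable planarMap := by
  have := measurable_fR.comp measurable_chart
  exact (measurable_pi_apply 1 |>.comp this).prodMk (measurable_pi_apply 2 |>.comp this)

lemma chart_planarMap (p : ℝ × ℝ) : chart (planarMap p) = fR (chart p) := by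
  have h : fR (chart p) 0 + fR (chart p) 1 + fR (chart p) 2 = 1 := by
    have hs : chart p 0 + chart p 1 + chart p 2 = 1 := by simp [chart]; ring
    generalize chart p = x at *
    unfold fR
    split_ifs with a b c
    · have : x 0 ≠ 0 := by rintro h; norm_num [h] at a
      simp; field_simp; ring
    · have : x 1 ≠ 0 := by rintro h; norm_num [h] at b
      simp; field_simp; ring
    · have : x 2 ≠ 0 := by rintro h; norm_num [h] at c
      simp; field_simp; ring
    · simp; linarith
  ext i
  fin_cases i
  · change 1 - fR (chart p) 1 - fR (chart p) 2 = fR (chart p) 0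
    linarith
  · simp [chart, planarMap]
  · simp [chart, planarMap]

/-- Contribution of one inverse branch `g` of the planar map to the pushforward of the measure. -/
lemma lintegral_le_nuR_of_branch {g : ℝ × ℝ → ℝ × ℝ} {g' : ℝ × ℝ → ℝ × ℝ →L[ℝ] ℝ × ℝ} {a : Fin 4}
    {k : ℝ × ℝ → ℝ} (hg : ∀ p ∈ triangle, HasFDerivAt g (g' p) p)
    (hgt : ∀ p ∈ triangle, g p ∈ triangle) (hgd : ∀ p ∈ triangle, digit (chart (g p)) = a)
    (hinv : ∀ p ∈ triangle, planarMap (g p) = p)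
    (hk : ∀ p ∈ triangle, k p = |(g' p).det| * dens (g p))
    {B : Set (ℝ × ℝ)} (hB : MeasurableSet B) :
    ∫⁻ p in B ∩ triangle, ENNReal.ofReal (k p) ≤
      nuR (planarMap ⁻¹' B ∩ {p | digit (chart p) = a}) := by
  have hBm := hB.inter measurableSet_triangle
  have hinj : Set.InjOn g (B ∩ triangle) := fun p hp q hq h => by
    rw [← hinv p hp.2, h, hinv q hq.2]
  have hder : ∀ p ∈ B ∩ triangle, HasFDerivWithinAt g (g' p) (B ∩ triangle) p :=
    fun p hp => (hg p hp.2).hasFDerivWithinAt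
  have him : MeasurableSet (g '' (B ∩ triangle)) := measurable_image_of_fderivWithin hBm hder hinj
  calc ∫⁻ p in B ∩ triangle, ENNReal.ofReal (k p)
      = ∫⁻ p in B ∩ triangle, ENNReal.ofReal |(g' p).det| * ENNReal.ofReal (dens (g p)) := by
        refine setLIntegral_congr_fun hBm fun p hp => ?_
        simp only [hk p hp.2, ENNReal.ofReal_mul (abs_nonneg _)]
    _ = ∫⁻ p in g '' (B ∩ triangle), ENNReal.ofReal (dens p) :=
        (lintegral_image_eq_lintegral_abs_det_fderiv_mul volume hBm hder hinj
          fun p => ENNReal.ofReal (dens p)).symm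
    _ = nuR (g '' (B ∩ triangle)) := by
        have hsub : g '' (B ∩ triangle) ⊆ triangle := by
          rintro _ ⟨p, hp, rfl⟩
          exact hgt p hp.2
        rw [nuR, withDensity_apply _ him, Measure.restrict_restrict him,
          Set.inter_eq_left.2 hsub]
    _ ≤ _ := by
        refine measure_mono ?_
        rintro _ ⟨p, hp, rfl⟩
        exact ⟨by simpa [hinv p hp.2] using hp.1, hgd p hp.2⟩

/-- The continuous linear endomorphism of the plane with the given matrix entries. -/
def planarCLM (a b c d : ℝ) : ℝ × ℝ →L[ℝ] ℝ × ℝ :=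
  (a • ContinuousLinearMap.fst ℝ ℝ ℝ + b • ContinuousLinearMap.snd ℝ ℝ ℝ).prod
    (c • ContinuousLinearMap.fst ℝ ℝ ℝ + d • ContinuousLinearMap.snd ℝ ℝ ℝ)

lemma det_planarCLM (a b c d : ℝ) : (planarCLM a b c d).det = a * d - b * c := by
  rw [ContinuousLinearMap.det, ← LinearMap.det_toMatrix (Module.Basis.finTwoProd ℝ),
    Matrix.det_fin_two]
  simp [LinearMap.toMatrix_apply, planarCLM]

/-- The derivative of a quotient of an affine function by an affine function. -/
lemma hasFDerivAt_div_affine (a b c l m n : ℝ) (p : ℝ × ℝ) (h : l + m * p.1 + n * p.2 ≠ 0) :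
    HasFDerivAt (fun p : ℝ × ℝ => (a + b * p.1 + c * p.2) / (l + m * p.1 + n * p.2))
      (((b * (l + m * p.1 + n * p.2) - (a + b * p.1 + c * p.2) * m) /
          (l + m * p.1 + n * p.2) ^ 2) • ContinuousLinearMap.fst ℝ ℝ ℝ +
        ((c * (l + m * p.1 + n * p.2) - (a + b * p.1 + c * p.2) * n) /
          (l + m * p.1 + n * p.2) ^ 2) • ContinuousLinearMap.snd ℝ ℝ ℝ) p := by
  have aff : ∀ a b c : ℝ, HasFDerivAt (fun p : ℝ × ℝ => a + b * p.1 + c * p.2)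
      (b • ContinuousLinearMap.fst ℝ ℝ ℝ + c • ContinuousLinearMap.snd ℝ ℝ ℝ) p := fun a b c =>
    ((hasFDerivAt_fst.const_mul b).const_add a).add (hasFDerivAt_snd.const_mul c)
  have := (aff a b c).mul ((hasDerivAt_inv h).comp_hasFDerivAt p (aff l m n))
  refine (this.congr_fderiv ?_).congr_of_eventuallyEq (.of_forall fun q => div_eq_mul_inv _ _)
  ext <;> simp <;> field_simp <;> ring

/-- A projective map of the plane. -/
def projMap (N : Matrix (Fin 3) (Fin 3) ℝ) (p : ℝ × ℝ) : ℝ × ℝ :=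
  ((N 1 0 + N 1 1 * p.1 + N 1 2 * p.2) / (N 0 0 + N 0 1 * p.1 + N 0 2 * p.2),
    (N 2 0 + N 2 1 * p.1 + N 2 2 * p.2) / (N 0 0 + N 0 1 * p.1 + N 0 2 * p.2))

/-- The Jacobian of a projective map of the plane. -/
lemma exists_hasFDerivAt_projMap (N : Matrix (Fin 3) (Fin 3) ℝ) (p : ℝ × ℝ)
    (h : N 0 0 + N 0 1 * p.1 + N 0 2 * p.2 ≠ 0) :
    ∃ g' : ℝ × ℝ →L[ℝ] ℝ × ℝ, HasFDerivAt (projMap N) g' p ∧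
      g'.det = N.det / (N 0 0 + N 0 1 * p.1 + N 0 2 * p.2) ^ 3 := by
  refine ⟨planarCLM _ _ _ _, (hasFDerivAt_div_affine (N 1 0) (N 1 1) (N 1 2) _ _ _ p h).prodMk
    (hasFDerivAt_div_affine (N 2 0) (N 2 1) (N 2 2) _ _ _ p h), ?_⟩
  rw [det_planarCLM, Matrix.det_fin_three]
  field_simp
  ring

/-- Contribution of one projective inverse branch of the planar map. -/
lemma lintegral_le_nuR_of_projMap (N : Matrix (Fin 3) (Fin 3) ℝ) (a : Fin 4)
    (hN : ∀ p ∈ triangle, 0 < N 0 0 + N 0 1 * p.1 + N 0 2 * p.2)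
    (hgt : ∀ p ∈ triangle, projMap N p ∈ triangle)
    (hgd : ∀ p ∈ triangle, digit (chart (projMap N p)) = a)
    (hinv : ∀ p ∈ triangle, planarMap (projMap N p) = p)
    {B : Set (ℝ × ℝ)} (hB : MeasurableSet B) :
    ∫⁻ p in B ∩ triangle, ENNReal.ofReal
        (|N.det| / (N 0 0 + N 0 1 * p.1 + N 0 2 * p.2) ^ 3 * dens (projMap N p)) ≤
      nuR (planarMap ⁻¹' B ∩ {p | digit (chart p) = a}) := by
  choose! g' hg' hdet using fun p hp => exists_hasFDerivAt_projMap N p (hN p hp).ne'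
  refine lintegral_le_nuR_of_branch hg' hgt hgd hinv (fun p hp => ?_) hB
  rw [hdet p hp, abs_div, abs_of_pos (pow_pos (hN p hp) 3)]

/-- The inverse branches of the planar map, as projective maps. -/
def branch : Fin 4 → Matrix (Fin 3) (Fin 3) ℝ :=
  ![!![1, 1, 1; 0, 1, 0; 0, 0, 1], !![2, -1, 0; 1, 0, 0; 0, 0, 1],
    !![2, 0, -1; 0, 1, 0; 1, 0, 0], !![2, 0, 0; 1, -1, 0; 1, 0, -1]]

lemma branch_denom_pos (a : Fin 4) {p : ℝ × ℝ} (hp : p ∈ triangle) :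
    0 < branch a 0 0 + branch a 0 1 * p.1 + branch a 0 2 * p.2 := by
  obtain ⟨h1, h2, h3⟩ := hp
  fin_cases a <;> simp [branch] <;> linarith

lemma projMap_branch_mem (a : Fin 4) {p : ℝ × ℝ} (hp : p ∈ triangle) :
    projMap (branch a) p ∈ triangle := by
  have hd := branch_denom_pos a hp
  obtain ⟨h1, h2, h3⟩ := hp
  refine ⟨div_pos ?_ hd, div_pos ?_ hd, ?_⟩
  · fin_cases a <;> simp [branch] <;> linarith
  · fin_cases a <;> simp [branch] <;> linarith
  · simp only [projMap]
    rw [← add_div, div_lt_one hd]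
    fin_cases a <;> simp [branch] <;> linarith

lemma digit_chart_projMap_branch (a : Fin 4) {p : ℝ × ℝ} (hp : p ∈ triangle) :
    digit (chart (projMap (branch a) p)) = a := by
  have hd := branch_denom_pos a hp
  have e0 : 1 < 2 * chart (projMap (branch a) p) 0 ↔ a = 0 := by
    obtain ⟨h1, h2, h3⟩ := hp
    simp only [chart, projMap, Matrix.cons_val_zero]
    rw [← sub_pos, show ∀ x y z : ℝ, 2 * (1 - x / z - y / z) - 1 = 1 - 2 * (x + y) / z by
      intros; ring, sub_pos, div_lt_one hd]
    fin_cases a <;> simp [branch] <;> linarith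
  have e1 : 1 < 2 * chart (projMap (branch a) p) 1 ↔ a = 1 := by
    obtain ⟨h1, h2, h3⟩ := hp
    simp only [chart, projMap, Matrix.cons_val_one, Matrix.cons_val_zero]
    rw [← mul_div_assoc, one_lt_div hd]
    fin_cases a <;> simp [branch] <;> linarith
  have e2 : 1 < 2 * chart (projMap (branch a) p) 2 ↔ a = 2 := by
    obtain ⟨h1, h2, h3⟩ := hp
    simp only [chart, projMap, Matrix.cons_val]
    rw [← mul_div_assoc, one_lt_div hd]
    fin_cases a <;> simp [branch] <;> linarith
  simp only [digit, e0, e1, e2]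
  fin_cases a <;> simp

lemma fR_eq_of_digit (x : Fin 3 → ℝ) : fR x =
    (![![(x 0 - x 1 - x 2) / x 0, x 1 / x 0, x 2 / x 0],
      ![x 0 / x 1, (-x 0 + x 1 - x 2) / x 1, x 2 / x 1],
      ![x 0 / x 2, x 1 / x 2, (-x 0 - x 1 + x 2) / x 2],
      ![-x 0 + x 1 + x 2, x 0 - x 1 + x 2, x 0 + x 1 - x 2]] : Fin 4 → Fin 3 → ℝ) (digit x) := by
  unfold fR digit
  split_ifs <;> rfl

lemma planarMap_projMap_branch (a : Fin 4) {p : ℝ × ℝ} (hp : p ∈ triangle) :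
    planarMap (projMap (branch a) p) = p := by
  have hd := branch_denom_pos a hp
  rw [planarMap, fR_eq_of_digit, digit_chart_projMap_branch a hp]
  obtain ⟨h1, h2, h3⟩ := hp
  fin_cases a <;> simp [branch] at hd <;> simp [chart, projMap, branch] <;> ext <;>
    simp [← sub_eq_add_neg]
  all_goals first
    | (have := (sub_pos.2 hd).ne'; field_simp <;> ring)
    | (field_simp; ring)

/-- The transfer equation: the density is fixed by the transfer operator. -/
lemma sum_branch_dens {p : ℝ × ℝ} (hp : p ∈ triangle) :
    ∑ a, |(branch a).det| / (branch a 0 0 + branch a 0 1 * p.1 + branch a 0 2 * p.2) ^ 3 *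
      dens (projMap (branch a) p) = dens p := by
  obtain ⟨h1, h2, h3⟩ := hp
  have d0 : (branch 0).det = 1 := by simp [branch, Matrix.det_fin_three]
  have d1 : (branch 1).det = 1 := by simp [branch, Matrix.det_fin_three]
  have d2 : (branch 2).det = 1 := by simp [branch, Matrix.det_fin_three]
  have d3 : (branch 3).det = 2 := by simp [branch, Matrix.det_fin_three]
  have e0 : 1 / (1 + p.1 + p.2) ^ 3 * dens (projMap (branch 0) p) =
      4 / (Real.pi ^ 2 * (p.1 + p.2) * (1 + p.2) * (1 + p.1)) := by
    have : 1 + p.1 + p.2 ≠ 0 := by positivity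
    have : 1 - p.1 / (1 + p.1 + p.2) = (1 + p.2) / (1 + p.1 + p.2) := by field_simp; ring
    have : 1 - p.2 / (1 + p.1 + p.2) = (1 + p.1) / (1 + p.1 + p.2) := by field_simp; ring
    simp [branch, projMap, dens, *]
    field_simp
  have e1 : 1 / (2 - p.1) ^ 3 * dens (projMap (branch 1) p) =
      4 / (Real.pi ^ 2 * (1 + p.2) * (1 - p.1) * (2 - p.1 - p.2)) := by
    have : 2 - p.1 ≠ 0 := by linarith
    have : 1 - (2 - p.1)⁻¹ = (1 - p.1) / (2 - p.1) := by field_simp; ring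
    have : 1 - p.2 / (2 - p.1) = (2 - p.1 - p.2) / (2 - p.1) := by field_simp
    have : 1 - p.1 ≠ 0 := by linarith
    have : 2 - p.1 - p.2 ≠ 0 := by linarith
    simp [branch, projMap, dens, *, ← sub_eq_add_neg]
    field_simp
  have e2 : 1 / (2 - p.2) ^ 3 * dens (projMap (branch 2) p) =
      4 / (Real.pi ^ 2 * (1 + p.1) * (1 - p.2) * (2 - p.1 - p.2)) := by
    have : 2 - p.2 ≠ 0 := by linarith
    have : 1 - (2 - p.2)⁻¹ = (1 - p.2) / (2 - p.2) := by field_simp; ring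
    have : 1 - p.1 / (2 - p.2) = (2 - p.1 - p.2) / (2 - p.2) := by field_simp; ring
    have : 1 - p.2 ≠ 0 := by linarith
    have : 2 - p.1 - p.2 ≠ 0 := by linarith
    simp [branch, projMap, dens, *, ← sub_eq_add_neg]
    field_simp
    ring
  have e3 : 2 / 2 ^ 3 * dens (projMap (branch 3) p) =
      8 / (Real.pi ^ 2 * (2 - p.1 - p.2) * (1 + p.1) * (1 + p.2)) := by
    have : 1 - (1 - p.1) / 2 = (1 + p.1) / 2 := by ring
    have : 1 - (1 - p.2) / 2 = (1 + p.2) / 2 := by ring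
    have : (1 - p.1) / 2 + (1 - p.2) / 2 = (2 - p.1 - p.2) / 2 := by ring
    have : 2 - p.1 - p.2 ≠ 0 := by linarith
    simp [branch, projMap, dens, *, ← sub_eq_add_neg]
    field_simp
    norm_num
  have l0 : branch 0 0 0 + branch 0 0 1 * p.1 + branch 0 0 2 * p.2 = 1 + p.1 + p.2 := by
    simp [branch]
  have l1 : branch 1 0 0 + branch 1 0 1 * p.1 + branch 1 0 2 * p.2 = 2 - p.1 := by
    simp [branch]; ring
  have l2 : branch 2 0 0 + branch 2 0 1 * p.1 + branch 2 0 2 * p.2 = 2 - p.2 := by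
    simp [branch]; ring
  have l3 : branch 3 0 0 + branch 3 0 1 * p.1 + branch 3 0 2 * p.2 = 2 := by
    simp [branch]
  rw [Fin.sum_univ_four, d0, d1, d2, d3, l0, l1, l2, l3, abs_one, abs_two, e0, e1, e2, e3, dens]
  have : p.1 + p.2 ≠ 0 := by positivity
  have : 1 - p.1 ≠ 0 := by linarith
  have : 1 - p.2 ≠ 0 := by linarith
  have : 2 - p.1 - p.2 ≠ 0 := by linarith
  field_simp
  ring

lemma nuR_le_nuR_preimage {B : Set (ℝ × ℝ)} (hB : MeasurableSet B) :
    nuR B ≤ nuR (planarMap ⁻¹' B) := by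
  have hBm := hB.inter measurableSet_triangle
  have hnn : ∀ p ∈ triangle, 0 ≤ dens p := by
    rintro p ⟨h1, h2, h3⟩
    have : 0 < 1 - p.1 := by linarith
    have : 0 < 1 - p.2 := by linarith
    unfold dens
    positivity
  calc nuR B = ∫⁻ p in B ∩ triangle, ENNReal.ofReal (dens p) := by
        rw [nuR, withDensity_apply _ hB, Measure.restrict_restrict hB]
    _ = ∫⁻ p in B ∩ triangle, ∑ a, ENNReal.ofReal (|(branch a).det| /
          (branch a 0 0 + branch a 0 1 * p.1 + branch a 0 2 * p.2) ^ 3 *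
            dens (projMap (branch a) p)) := by
        refine setLIntegral_congr_fun hBm fun p hp => ?_
        rw [← sum_branch_dens hp.2, ENNReal.ofReal_sum_of_nonneg]
        intro a _
        have := branch_denom_pos a hp.2
        exact mul_nonneg (by positivity) (hnn _ (projMap_branch_mem a hp.2))
    _ = ∑ a, ∫⁻ p in B ∩ triangle, ENNReal.ofReal (|(branch a).det| /
          (branch a 0 0 + branch a 0 1 * p.1 + branch a 0 2 * p.2) ^ 3 *
            dens (projMap (branch a) p)) := by
        refine lintegral_finsetSum _ fun a _ => ?_
        have := measurable_dens
        unfold projMap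
        fun_prop
    _ ≤ ∑ a, nuR (planarMap ⁻¹' B ∩ {p | digit (chart p) = a}) :=
        Finset.sum_le_sum fun a _ => lintegral_le_nuR_of_projMap _ _
          (fun p hp => branch_denom_pos a hp) (fun p hp => projMap_branch_mem a hp)
          (fun p hp => digit_chart_projMap_branch a hp)
          (fun p hp => planarMap_projMap_branch a hp) hB
    _ = nuR (⋃ a ∈ Finset.univ, planarMap ⁻¹' B ∩ {p | digit (chart p) = a}) := by
        refine (measure_biUnion_finset ?_ fun a _ => ?_).symm
        · intro a _ b _ hab
          refine Set.disjoint_left.2 fun p ha hb => hab ?_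
          rw [← ha.2, hb.2]
        · exact (measurable_planarMap hB).inter
            ((measurable_digit.comp measurable_chart) (measurableSet_singleton a))
    _ ≤ _ := measure_mono (by simp)

lemma inv_le_rpow_mul_rpow {u v w : ℝ} (hu : 0 < u) (hv : 0 < v) (huw : u ≤ w) (hvw : v ≤ w) :
    w⁻¹ ≤ u ^ (-(1 / 2) : ℝ) * v ^ (-(1 / 2) : ℝ) := by
  have hw := hu.trans_le huw
  calc w⁻¹ = w ^ (-(1 / 2) : ℝ) * w ^ (-(1 / 2) : ℝ) := by
        rw [← Real.rpow_add hw, ← Real.rpow_neg_one]; norm_num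
    _ ≤ _ := mul_le_mul (Real.rpow_le_rpow_of_nonpos hu huw (by norm_num))
        (Real.rpow_le_rpow_of_nonpos hv hvw (by norm_num)) (by positivity) (by positivity)

lemma dens_le {p : ℝ × ℝ} (hp : p ∈ triangle) : dens p ≤
    4 / Real.pi ^ 2 * (p.1 ^ (-(1 / 2) : ℝ) * p.2 ^ (-(1 / 2) : ℝ) +
      (1 - p.1) ^ (-(1 / 2) : ℝ) * p.2 ^ (-(1 / 2) : ℝ) +
      p.1 ^ (-(1 / 2) : ℝ) * (1 - p.2) ^ (-(1 / 2) : ℝ)) := by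
  obtain ⟨h1, h2, h3⟩ := hp
  have ha : 0 < p.1 + p.2 := by linarith
  have hb : 0 < 1 - p.1 := by linarith
  have hc : 0 < 1 - p.2 := by linarith
  calc dens p = 4 / Real.pi ^ 2 * (1 / ((p.1 + p.2) * (1 - p.1) * (1 - p.2))) := by
        unfold dens; field_simp
    _ ≤ 4 / Real.pi ^ 2 * ((p.1 + p.2)⁻¹ + (1 - p.1)⁻¹ + (1 - p.2)⁻¹) := by
        gcongr
        rw [div_le_iff₀ (by positivity)]
        field_simp
        nlinarith [mul_pos h1 h2, mul_pos (mul_pos h1 h2) (sub_pos.2 h3)]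
    _ ≤ _ := by
        gcongr
        · exact inv_le_rpow_mul_rpow h1 h2 (by linarith) (by linarith)
        · exact inv_le_rpow_mul_rpow hb h2 le_rfl (by linarith)
        · exact inv_le_rpow_mul_rpow h1 hc (by linarith) le_rfl

lemma isFiniteMeasure_nuR : IsFiniteMeasure nuR := by
  have hu : IntegrableOn (fun t : ℝ => t ^ (-(1 / 2) : ℝ)) (Set.Ioo 0 1) :=
    (intervalIntegral.intervalIntegrable_rpow' (by norm_num)).1.mono_set Set.Ioo_subset_Ioc_self
  have hv : IntegrableOn (fun t : ℝ => (1 - t) ^ (-(1 / 2) : ℝ)) (Set.Ioo 0 1) := by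
    have := (intervalIntegral.intervalIntegrable_rpow' (a := 0) (b := 1)
      (r := -(1 / 2)) (by norm_num)).comp_sub_left 1
    rw [sub_zero, sub_self] at this
    exact this.2.mono_set Set.Ioo_subset_Ioc_self
  have hG : IntegrableOn (fun p : ℝ × ℝ =>
      4 / Real.pi ^ 2 * (p.1 ^ (-(1 / 2) : ℝ) * p.2 ^ (-(1 / 2) : ℝ) +
      (1 - p.1) ^ (-(1 / 2) : ℝ) * p.2 ^ (-(1 / 2) : ℝ) +
      p.1 ^ (-(1 / 2) : ℝ) * (1 - p.2) ^ (-(1 / 2) : ℝ))) triangle := by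
    refine IntegrableOn.mono_set (t := Set.Ioo 0 1 ×ˢ Set.Ioo 0 1) ?_ ?_
    · rw [IntegrableOn, Measure.volume_eq_prod, ← Measure.prod_restrict]
      exact (((hu.mul_prod hu).add (hv.mul_prod hu)).add (hu.mul_prod hv)).const_mul _
    · rintro p ⟨h1, h2, h3⟩
      exact ⟨⟨h1, by linarith⟩, ⟨h2, by linarith⟩⟩
  refine ⟨?_⟩
  rw [nuR, withDensity_apply _ MeasurableSet.univ, Measure.restrict_univ]
  calc _ ≤ _ := setLIntegral_mono_ae' measurableSet_triangle
        (.of_forall fun p hp => ENNReal.ofReal_le_ofReal (dens_le hp))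
    _ < _ := hG.lintegral_lt_top

lemma isFiniteMeasure_muR : IsFiniteMeasure muR := by
  have := isFiniteMeasure_nuR
  rw [muR_eq]; infer_instance

lemma measurePreserving_planarMap : MeasurePreserving planarMap nuR nuR := by
  have := isFiniteMeasure_nuR
  refine ⟨measurable_planarMap, (Measure.eq_of_le_of_measure_univ_eq ?_ ?_).symm⟩
  · refine Measure.le_iff.2 fun B hB => ?_
    rw [Measure.map_apply measurable_planarMap hB]
    exact nuR_le_nuR_preimage hB
  · rw [Measure.map_apply measurable_planarMap MeasurableSet.univ, Set.preimage_univ]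

lemma measurePreserving_fR : MeasurePreserving fR muR muR := by
  refine ⟨measurable_fR, ?_⟩
  rw [muR_eq, Measure.map_map measurable_fR measurable_chart,
    show fR ∘ chart = chart ∘ planarMap from funext fun p => (chart_planarMap p).symm,
    ← Measure.map_map measurable_chart measurable_planarMap, measurePreserving_planarMap.map_eq]

lemma measurableSet_simplexBar : MeasurableSet simplexBar := by
  simp only [simplexBar, Set.ofPred_and, Set.ofPred_forall]
  refine (MeasurableSet.iInter fun i => ?_).inter ?_
  · exact measurableSet_le measurable_const (measurable_pi_apply i)
  · exact measurableSet_eq_fun (by fun_prop) (by fun_prop)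

lemma ae_mem_simplexBar : ∀ᵐ x ∂muR, x ∈ simplexBar := by
  rw [muR_eq]
  refine (ae_map_iff measurable_chart.aemeasurable measurableSet_simplexBar).2 ?_
  refine (withDensity_absolutelyContinuous _ _).ae_le ?_
  refine (ae_restrict_iff' measurableSet_triangle).2 (.of_forall ?_)
  rintro p ⟨h1, h2, h3⟩
  refine ⟨fun i => ?_, by simp [chart]; ring⟩
  fin_cases i <;> simp [chart] <;> linarith

lemma measurableSet_wordCylinder : MeasurableSet wordCylinder := by
  refine measurableSet_simplexBar.inter ?_
  simp only [Set.ofPred_and]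
  exact (measurableSet_lt (by fun_prop) (by fun_prop)).inter
    ((measurableSet_lt (by fun_prop) (by fun_prop)).inter
      (measurableSet_lt (by fun_prop) (by fun_prop)))

lemma muR_wordCylinder_ne_zero : muR wordCylinder ≠ 0 := by
  rw [muR_eq, Measure.map_apply measurable_chart measurableSet_wordCylinder]
  set U : Set (ℝ × ℝ) := {p | 0 < p.1 ∧ 0 < p.2 ∧ p.1 + p.2 < 1 ∧ 2 * p.1 + 2 * p.2 < 1 ∧
    1 < 3 * p.1 + p.2 ∧ p.1 < 2 * p.2} with hU
  have hUo : IsOpen U := by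
    simp only [hU, Set.ofPred_and]
    refine IsOpen.inter ?_ <| IsOpen.inter ?_ <| IsOpen.inter ?_ <| IsOpen.inter ?_ <|
      IsOpen.inter ?_ ?_
    all_goals exact isOpen_lt (by fun_prop) (by fun_prop)
  have hUt : U ⊆ triangle := fun p hp => ⟨hp.1, hp.2.1, hp.2.2.1⟩
  have hUne : U.Nonempty := ⟨(5 / 17, 3 / 17), by norm_num [hU]⟩
  have hUw : U ⊆ chart ⁻¹' wordCylinder := by
    rintro p ⟨h1, h2, h3, h4, h5, h6⟩
    refine ⟨⟨fun i => ?_, by simp [chart]; ring⟩, ?_, ?_, ?_⟩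
    · fin_cases i <;> simp [chart] <;> linarith
    all_goals simp [chart]; linarith
  intro h0
  have hU0 : nuR U = 0 := measure_mono_null hUw h0
  rw [nuR, withDensity_apply_eq_zero measurable_dens.ennreal_ofReal,
    Measure.restrict_apply] at hU0
  · refine (hUo.measure_pos volume hUne).ne' (measure_mono_null (fun p hp => ?_) hU0)
    obtain ⟨h1, h2, h3⟩ := hUt hp
    refine ⟨⟨?_, hp⟩, hUt hp⟩
    have : 0 < 1 - p.1 := by linarith
    have : 0 < 1 - p.2 := by linarith
    have : 0 < dens p := by unfold dens; positivity
    simpa using this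
  · exact (measurable_dens.ennreal_ofReal (measurableSet_singleton 0).compl).inter
      hUo.measurableSet

lemma ae_wordCylinder_frequently :
    ∀ᵐ x ∂muR, x ∈ wordCylinder → ∃ᶠ n in Filter.atTop, fR^[n] x ∈ wordCylinder :=
  have := isFiniteMeasure_muR
  measurePreserving_fR.conservative.ae_mem_imp_frequently_image_mem
    measurableSet_wordCylinder.nullMeasurableSet

/-! ### The integral -/

lemma measurable_Acoc_apply (n : ℕ) (i j : Fin 3) : Measurable fun x => Acoc n x i j := by
  induction n generalizing j with
  | zero => simp [Acoc]
  | succ n ih =>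
    simp only [Acoc, Matrix.mul_apply, Matrix.transpose_apply]
    exact Finset.measurable_sum _ fun k _ => ((ih k).comp measurable_fR).mul
      ((measurable_of_finite fun a => Mat a j k).comp measurable_digit)

lemma measurable_colSumNorm_Dcoc (n : ℕ) : Measurable fun x => colSumNorm (Dcoc n x) := by
  have hD : ∀ i j, Measurable fun x => Dcoc n x i j := by
    intro i j
    simp only [Dcoc, Matrix.mul_apply]
    refine Finset.measurable_sum _ fun k _ => (Finset.measurable_sum _ fun l _ =>
      (measurable_Acoc_apply n l k).const_mul _).mul ?_
    fin_cases k <;> fin_cases j <;> simp [Hmat] <;> fun_prop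
  unfold colSumNorm
  fun_prop

lemma colSumNorm_Dcoc_pos {x : Fin 3 → ℝ} (hx : x ∈ simplexBar) (n : ℕ) :
    0 < colSumNorm (Dcoc n x) :=
  (by positivity : (0 : ℝ) < (4 ^ n)⁻¹).trans_le (inv_four_pow_le_colSumNorm_Dcoc hx n)

lemma integrable_log_colSumNorm_Dcoc (n : ℕ) :
    Integrable (fun x => Real.log (colSumNorm (Dcoc n x))) muR := by
  have := isFiniteMeasure_muR
  refine Integrable.of_bound (measurable_colSumNorm_Dcoc n).log.aestronglyMeasurable
    (max (Real.log 2) (Real.log (4 ^ n))) ?_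
  filter_upwards [ae_mem_simplexBar] with x hx
  have hpos := colSumNorm_Dcoc_pos hx n
  have h1 := Real.log_le_log hpos (colSumNorm_Dcoc_le_two hx n)
  have h2 := Real.log_le_log (by positivity) (inv_four_pow_le_colSumNorm_Dcoc hx n)
  rw [Real.log_inv] at h2
  rw [Real.norm_eq_abs, abs_le]
  exact ⟨by linarith [le_max_right (Real.log 2) (Real.log (4 ^ n))], h1.trans (le_max_left _ _)⟩

/-- For every `ε > 0`, the norm of `D` is eventually at most `ε` on a set of measure bounded
away from zero. -/
lemma exists_one_le_measure_colSumNorm_le {ε : ℝ} (hε : 0 < ε) : ∃ n, 1 ≤ n ∧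
    muR.real wordCylinder / 2 ≤ muR.real {x | colSumNorm (Dcoc n x) ≤ ε} := by
  have := isFiniteMeasure_muR
  set S : ℕ → Set (Fin 3 → ℝ) := fun n => {x | ∀ m ≥ n, colSumNorm (Dcoc m x) ≤ ε} with hS
  have hmono : Monotone S := fun n m hnm x hx k hk => hx k (hnm.trans hk)
  have hsub : muR wordCylinder ≤ muR (⋃ n, S n) := by
    refine measure_mono_ae ?_
    filter_upwards [ae_wordCylinder_frequently] with x hx hxw
    obtain ⟨n, hn⟩ := Filter.eventually_atTop.1 (eventually_colSumNorm_Dcoc_le hxw.1 (hx hxw) hε)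
    exact Set.mem_iUnion.2 ⟨n, hn⟩
  have hlt : muR wordCylinder / 2 < muR (⋃ n, S n) :=
    (ENNReal.half_lt_self muR_wordCylinder_ne_zero (measure_ne_top _ _)).trans_le hsub
  obtain ⟨n, hn, hn1⟩ := (((tendsto_measure_iUnion_atTop hmono).eventually_const_lt hlt).and
    (Filter.eventually_ge_atTop 1)).exists
  refine ⟨n, hn1, ?_⟩
  have hle : muR wordCylinder / 2 ≤ muR {x | colSumNorm (Dcoc n x) ≤ ε} :=
    hn.le.trans (measure_mono fun x hx => hx n le_rfl)
  simpa [Measure.real, ENNReal.toReal_div] using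
    ENNReal.toReal_mono (measure_ne_top _ _) hle

/-- There exists n ≥ 1 with `∫ log‖D^{(n)}(x)‖ dμ(x) < 0`, where ‖·‖ is the
operator norm induced by the ℓ¹ norm on ℝ². -/
theorem integral_log_D_negative :
    ∃ n : ℕ, 1 ≤ n ∧ (∫ x, Real.log (colSumNorm (Dcoc n x)) ∂muR) < 0 := by
  have := isFiniteMeasure_muR
  set δ := muR.real wordCylinder / 2 with hδ
  have hδ0 : 0 < δ :=
    half_pos (ENNReal.toReal_pos muR_wordCylinder_ne_zero (measure_ne_top _ _))
  set T := (Real.log 2 * muR.real Set.univ + 1) / δ with hT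
  have hT0 : 0 ≤ T := div_nonneg (by positivity) hδ0.le
  obtain ⟨n, hn1, hn⟩ := exists_one_le_measure_colSumNorm_le (Real.exp_pos (Real.log 2 - T))
  refine ⟨n, hn1, ?_⟩
  set S := {x | colSumNorm (Dcoc n x) ≤ Real.exp (Real.log 2 - T)} with hS
  have hSm : MeasurableSet S := measurableSet_le (measurable_colSumNorm_Dcoc n) measurable_const
  have hindic : Integrable (S.indicator fun _ => -T) muR :=
    (integrable_const (-T)).indicator hSm
  calc ∫ x, Real.log (colSumNorm (Dcoc n x)) ∂muR
      ≤ ∫ x, (Real.log 2 + S.indicator (fun _ => -T) x) ∂muR := by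
        refine integral_mono_ae (integrable_log_colSumNorm_Dcoc n)
          ((integrable_const _).add hindic) ?_
        filter_upwards [ae_mem_simplexBar] with x hx
        have hpos := colSumNorm_Dcoc_pos hx n
        by_cases hxS : x ∈ S
        · rw [Set.indicator_of_mem hxS, ← sub_eq_add_neg]
          exact (Real.log_le_iff_le_exp hpos).2 hxS
        · rw [Set.indicator_of_notMem hxS, add_zero]
          exact Real.log_le_log hpos (colSumNorm_Dcoc_le_two hx n)
    _ = Real.log 2 * muR.real Set.univ - muR.real S * T := by
        rw [integral_add (integrable_const _) hindic, integral_indicator_const _ hSm]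
        simp; ring
    _ ≤ Real.log 2 * muR.real Set.univ - δ * T := by gcongr
    _ < 0 := by rw [hT, mul_div_cancel₀ _ hδ0.ne']; linarith

end
end

section
/- Let M = M₁·M₂·M₃ = [[4,3,2],[2,2,1],[1,1,1]]. Then for every w ∈ ℝ³ with strictly positive entries and every x ∈ ℝ³ satisfying ⟨M²·x, w⟩ = 0 (equivalently, x orthogonal to ᵗ(M²)·w), one has ‖M·x‖_∞ ≤ (5/7)·‖x‖_∞. -/
open Matrix

noncomputable section

/-- If a linear combination with positive coefficients vanishes, the combined values are not all
of the same strict sign. -/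
theorem exists_nonpos_and_exists_nonneg_of_sum_mul_eq_zero {ι : Type*} [Fintype ι] [Nonempty ι]
    {v w : ι → ℝ} (hw : ∀ i, 0 < w i) (h : ∑ i, v i * w i = 0) :
    (∃ i, v i ≤ 0) ∧ ∃ i, 0 ≤ v i := by
  constructor <;> by_contra! hv
  · exact (Finset.sum_pos (fun i _ => mul_pos (hv i) (hw i)) Finset.univ_nonempty).ne' h
  · exact (Finset.sum_neg (fun i _ => mul_neg_of_neg_of_pos (hv i) (hw i))
      Finset.univ_nonempty).ne h

theorem M1_mul_M2_mul_M3 : M1 * M2 * M3 = !![4,3,2; 2,2,1; 1,1,1] := by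
  rw [M1, M2, M3, Matrix.mul_fin_three, Matrix.mul_fin_three]
  norm_num

theorem sq_M1_mul_M2_mul_M3 :
    (M1 * M2 * M3) * (M1 * M2 * M3) = !![24,20,13; 13,11,7; 7,6,4] := by
  rw [M1_mul_M2_mul_M3, Matrix.mul_fin_three]
  norm_num

/-- With M = M₁M₂M₃, for every w with strictly positive entries and every x with
⟨M²x, w⟩ = 0 one has ‖Mx‖_∞ ≤ (5/7)‖x‖_∞.  (The norm on `Fin 3 → ℝ` is the
max norm.) -/
theorem contraction_on_hyperplane :
    ∀ w : Fin 3 → ℝ, (∀ i, 0 < w i) →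
      ∀ x : Fin 3 → ℝ,
        (∑ i, ((M1 * M2 * M3) * (M1 * M2 * M3)).mulVec x i * w i) = 0 →
        ‖(M1 * M2 * M3).mulVec x‖ ≤ 5 / 7 * ‖x‖ := by
  intro w hw x hx
  obtain ⟨⟨i, hi⟩, ⟨j, hj⟩⟩ := exists_nonpos_and_exists_nonneg_of_sum_mul_eq_zero hw hx
  rw [sq_M1_mul_M2_mul_M3] at hi hj
  rw [M1_mul_M2_mul_M3]
  have bound : ∀ k, -‖x‖ ≤ x k ∧ x k ≤ ‖x‖ := fun k => abs_le.mp (norm_le_pi_norm x k)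
  obtain ⟨h0, h0'⟩ := bound 0
  obtain ⟨h1, h1'⟩ := bound 1
  obtain ⟨h2, h2'⟩ := bound 2
  refine (pi_norm_le_iff_of_nonneg (by positivity)).mpr fun k => ?_
  rw [Real.norm_eq_abs, abs_le]
  fin_cases i <;> fin_cases j <;> fin_cases k <;>
    simp [Matrix.mulVec, dotProduct, Fin.sum_univ_three] at hi hj ⊢ <;>
    constructor <;> linarith

end
end
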